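/- There exists a constant c > 0 such that for every integer k ≥ 1 the complete planar 3-tree T_k with k levels and n = (3^k+5)/2 vertices satisfies mcc_2(T_k) ≥ c·n^{(log₃2)/2} (note (log₃2)/2 ≈ 0.315); equivalently, mcc_2(T_k) ≥ c·2^{k/2}. That is, in every 2-coloring of the vertices of T_k some monochromatic connected component has at least c·n^{(log₃2)/2} vertices. -/

import Mathlib

/-- The subgraph of `G` keeping only edges between vertices of the same color. -/
def monoSubgraph {V : Type*} {α : Type*} (G : SimpleGraph V) (c : V → α) : SimpleGraph V :=
  SimpleGraph.fromRel (fun a b => G.Adj a b ∧ c a = c b)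

/-- The monochromatic connected component of `v` under the coloring `c`. -/
def monoComponent {V : Type*} {α : Type*} (G : SimpleGraph V) (c : V → α) (v : V) : Set V :=
  {u | (monoSubgraph G c).Reachable v u}

/-- Vertices of the (infinite) complete planar 3-tree: the three outer vertices
`Sum.inl i`, and one vertex `Sum.inr s` for every internal face, where the face
inserted as child `j` of the face `s` is encoded `j :: s` (the root face is `[]`).
The vertex `Sum.inr s` is the central vertex inserted into the face `s`. -/
abbrev CP3V : Type := Fin 3 ⊕ List (Fin 3)

/-- The three corner vertices of the face `s`: the root face `[]` has the three outer
vertices as corners; the child face `j :: s` keeps the corners `i ≠ j` of `s` and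
replaces corner `j` by the central vertex of `s`. -/
def cp3corner : List (Fin 3) → Fin 3 → CP3V
  | [], i => Sum.inl i
  | j :: s, i => if i = j then Sum.inr s else cp3corner s i

/-- The infinite complete planar 3-tree: the three outer vertices are mutually adjacent,
and the central vertex of a face `s` is adjacent exactly to the three corners of `s`. -/
def cp3 : SimpleGraph CP3V :=
  SimpleGraph.fromRel (fun u v =>
    (∃ i j : Fin 3, u = Sum.inl i ∧ v = Sum.inl j) ∨
    (∃ (s : List (Fin 3)) (i : Fin 3), u = Sum.inr s ∧ cp3corner s i = v))

/-- The level of a vertex: outer vertices are at level `0`; the central vertex of a face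
`s` is at level `s.length + 1`. -/
def cp3level : CP3V → ℕ
  | Sum.inl _ => 0
  | Sum.inr s => s.length + 1

/-- The vertex set of the complete planar 3-tree `T k` with `k` levels. -/
def cp3verts (k : ℕ) : Set CP3V := {v | cp3level v ≤ k}

/-- The complete planar 3-tree `T k` with `k` levels. -/
def cp3tree (k : ℕ) : SimpleGraph (cp3verts k) :=
  SimpleGraph.induce (cp3verts k) cp3

/-- The outer vertex `v_i` as a vertex of `T k`. -/
def cp3outer (k : ℕ) (i : Fin 3) : cp3verts k :=
  ⟨Sum.inl i, Nat.zero_le k⟩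

theorem aux_grow (P : List (Fin 3) → Prop) (L : ℕ)
    (hstep : ∀ t, P t → t.length < L → ∃ i j : Fin 3, i ≠ j ∧ P (i :: t) ∧ P (j :: t))
    (s : List (Fin 3)) (hs : P s) (d : ℕ) (hd : s.length + d ≤ L) :
    ∃ F : Finset (List (Fin 3)), F.card = 2 ^ d ∧ ∀ t ∈ F, P t ∧ t.length = s.length + d := by
  induction d with
  | zero => exact ⟨{s}, by simp, by simpa using hs⟩
  | succ d ih =>
    obtain ⟨F, hF, hP⟩ := ih (by omega)
    have h2 : ∀ t, ∃ p : Fin 3 × Fin 3, t ∈ F → p.1 ≠ p.2 ∧ P (p.1 :: t) ∧ P (p.2 :: t) := by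
      intro t
      by_cases ht : t ∈ F
      · obtain ⟨h1, h2⟩ := hP t ht
        obtain ⟨i, j, h⟩ := hstep t h1 (by omega)
        exact ⟨(i, j), fun _ => h⟩
      · exact ⟨(0, 0), fun h => absurd h ht⟩
    choose p hp using h2
    refine ⟨F.biUnion (fun t => {(p t).1 :: t, (p t).2 :: t}), ?_, ?_⟩
    · rw [Finset.card_biUnion]
      · rw [Finset.sum_congr rfl (g := fun _ => 2), Finset.sum_const, hF, pow_succ, smul_eq_mul]
        intro t ht
        rw [Finset.card_pair]
        simpa using (hp t ht).1
      · intro x _ y _ hxy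
        rw [Function.onFun, Finset.disjoint_left]
        intro z hz hz'
        simp only [Finset.mem_insert, Finset.mem_singleton] at hz hz'
        apply hxy
        rcases hz with rfl | rfl <;> simp_all
    · intro t ht
      simp only [Finset.mem_biUnion, Finset.mem_insert, Finset.mem_singleton] at ht
      obtain ⟨u, hu, rfl | rfl⟩ := ht
      · exact ⟨(hp u hu).2.1, by simp [(hP u hu).2]; omega⟩
      · exact ⟨(hp u hu).2.2, by simp [(hP u hu).2]; omega⟩

theorem aux_fin (f : Fin 3 → Fin 2) (c : Fin 2) (h : ∃ i j, f i ≠ f j) :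
    ∃ i j : Fin 3, i ≠ j ∧ (∃ a b, Function.update f i c a ≠ Function.update f i c b) ∧
      (∃ a b, Function.update f j c a ≠ Function.update f j c b) := by
  revert f c
  decide

def auxR {k : ℕ} (col : cp3verts k → Fin 2) (a : cp3verts k) (u : CP3V) : Prop :=
  ∃ hu : u ∈ cp3verts k, (monoSubgraph (cp3tree k) col).Reachable a ⟨u, hu⟩

open Classical in
noncomputable def auxC {k : ℕ} (col : cp3verts k → Fin 2) (u : CP3V) : Fin 2 :=
  if h : u ∈ cp3verts k then col ⟨u, h⟩ else 0

theorem auxC_val {k : ℕ} (col : cp3verts k → Fin 2) (a : cp3verts k) : auxC col a.1 = col a := by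
  simp [auxC]

theorem auxR_refl {k : ℕ} (col : cp3verts k → Fin 2) (a : cp3verts k) : auxR col a a.1 :=
  ⟨a.2, SimpleGraph.Reachable.refl _⟩

theorem auxR_col {k : ℕ} (col : cp3verts k → Fin 2) (a : cp3verts k) (u : CP3V)
    (h : auxR col a u) : auxC col u = col a := by
  obtain ⟨hu, ⟨w⟩⟩ := h
  have : ∀ x y : cp3verts k, (monoSubgraph (cp3tree k) col).Walk x y → col x = col y := by
    intro x y w
    induction w with
    | nil => rfl
    | cons h _ ih =>
      rw [← ih]
      simp only [monoSubgraph, SimpleGraph.fromRel_adj] at h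
      rcases h.2 with h | h
      · exact h.2
      · exact h.2.symm
  rw [this _ _ w]
  simp [auxC, hu]

theorem auxR_adj {k : ℕ} (col : cp3verts k → Fin 2) (a : cp3verts k) (u v : CP3V)
    (h : auxR col a u) (hv : v ∈ cp3verts k) (hadj : cp3.Adj u v)
    (hc : auxC col u = auxC col v) : auxR col a v := by
  obtain ⟨hu, hr⟩ := h
  refine ⟨hv, hr.trans (SimpleGraph.Adj.reachable ?_)⟩
  simp only [monoSubgraph, SimpleGraph.fromRel_adj]
  refine ⟨?_, Or.inl ⟨hadj, ?_⟩⟩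
  · intro he
    exact hadj.ne (congrArg Subtype.val he)
  · simpa [auxC, hu, hv] using hc

theorem aux_corner_level (s : List (Fin 3)) (i : Fin 3) : cp3level (cp3corner s i) ≤ s.length := by
  induction s with
  | nil => simp [cp3corner, cp3level]
  | cons j s ih =>
    simp only [cp3corner]
    split_ifs
    · simp [cp3level]
    · simp; omega

theorem aux_adj_center (s : List (Fin 3)) (i : Fin 3) : cp3.Adj (cp3corner s i) (Sum.inr s) := by
  simp only [cp3, SimpleGraph.fromRel_adj]
  refine ⟨?_, Or.inr (Or.inr ⟨s, i, rfl, rfl⟩)⟩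
  intro h
  have := aux_corner_level s i
  rw [h] at this
  simp [cp3level] at this

theorem auxR_center {k : ℕ} (col : cp3verts k → Fin 2) (a : cp3verts k) (s : List (Fin 3))
    (i : Fin 3) (hs : s.length < k) (h : auxR col a (cp3corner s i))
    (hc : auxC col (cp3corner s i) = auxC col (Sum.inr s)) : auxR col a (Sum.inr s) :=
  auxR_adj col a _ _ h hs (aux_adj_center s i) hc

def auxGood {k : ℕ} (col : cp3verts k → Fin 2) (a b : cp3verts k) (s : List (Fin 3)) : Prop :=
  (∀ i, auxR col a (cp3corner s i) ∨ auxR col b (cp3corner s i)) ∧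
    ∃ i j, auxC col (cp3corner s i) ≠ auxC col (cp3corner s j)

theorem auxGood_center {k : ℕ} (col : cp3verts k → Fin 2) (a b : cp3verts k) (s : List (Fin 3))
    (h : auxGood col a b s) (hs : s.length < k) :
    auxR col a (Sum.inr s) ∨ auxR col b (Sum.inr s) := by
  obtain ⟨h1, i, j, hij⟩ := h
  have : ∃ l, auxC col (cp3corner s l) = auxC col (Sum.inr s) := by
    by_contra! hne
    have h1 := hne i
    have h2 := hne j
    omega
  obtain ⟨l, hl⟩ := this
  exact (h1 l).imp (fun h => auxR_center col a s l hs h hl) (fun h => auxR_center col b s l hs h hl)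

theorem aux_corner_update {k : ℕ} (col : cp3verts k → Fin 2) (s : List (Fin 3)) (j i : Fin 3) :
    auxC col (cp3corner (j :: s) i) =
      Function.update (fun i => auxC col (cp3corner s i)) j (auxC col (Sum.inr s)) i := by
  simp only [cp3corner, Function.update_apply]
  split_ifs <;> rfl

theorem auxGood_step {k : ℕ} (col : cp3verts k → Fin 2) (a b : cp3verts k) (s : List (Fin 3))
    (h : auxGood col a b s) (hs : s.length < k) :
    ∃ i j : Fin 3, i ≠ j ∧ auxGood col a b (i :: s) ∧ auxGood col a b (j :: s) := by
  have hcen := auxGood_center col a b s h hs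
  obtain ⟨i, j, hij, hi, hj⟩ := aux_fin (fun i => auxC col (cp3corner s i))
    (auxC col (Sum.inr s)) h.2
  have key : ∀ j l, auxR col a (cp3corner (j :: s) l) ∨ auxR col b (cp3corner (j :: s) l) := by
    intro j l
    simp only [cp3corner]
    split_ifs
    · exact hcen
    · exact h.1 l
  simp only [← aux_corner_update] at hi hj
  exact ⟨i, j, hij, ⟨key i, hi⟩, ⟨key j, hj⟩⟩

theorem aux_finite (k : ℕ) : (cp3verts k).Finite := by
  have h1 : (cp3verts k) ⊆ Set.range Sum.inl ∪ Sum.inr '' {l : List (Fin 3) | l.length ≤ k} := by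
    rintro (i | s) h
    · left; exact ⟨i, rfl⟩
    · right
      refine ⟨s, ?_, rfl⟩
      have : s.length + 1 ≤ k := h
      simp only [Set.mem_setOf_eq]; omega
  exact ((Set.finite_range _).union ((List.finite_length_le (Fin 3) k).image _)).subset h1

theorem aux_count {k : ℕ} (col : cp3verts k → Fin 2) (a b : cp3verts k)
    (F : Finset (List (Fin 3)))
    (h : ∀ t ∈ F, auxR col a (Sum.inr t) ∨ auxR col b (Sum.inr t)) :
    F.card ≤ (monoComponent (cp3tree k) col a).ncard
      + (monoComponent (cp3tree k) col b).ncard := by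
  haveI : Finite (cp3verts k) := (aux_finite k).to_subtype
  have hsub : (Sum.inr '' (F : Set (List (Fin 3))) : Set CP3V) ⊆
      Subtype.val '' (monoComponent (cp3tree k) col a ∪ monoComponent (cp3tree k) col b) := by
    rintro _ ⟨t, ht, rfl⟩
    rcases h t ht with ⟨hu, hr⟩ | ⟨hu, hr⟩
    · exact ⟨⟨_, hu⟩, Or.inl hr, rfl⟩
    · exact ⟨⟨_, hu⟩, Or.inr hr, rfl⟩
  have h1 := Set.ncard_le_ncard hsub (Set.toFinite _)
  rw [Set.ncard_image_of_injective _ Sum.inr_injective,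
    Set.ncard_image_of_injective _ Subtype.val_injective, Set.ncard_coe_finset] at h1
  exact h1.trans (Set.ncard_union_le _ _)

theorem aux_good_bound {k : ℕ} (col : cp3verts k → Fin 2) (a b : cp3verts k) (s : List (Fin 3))
    (h : auxGood col a b s) (d : ℕ) (hd : s.length + d < k) :
    2 ^ d ≤ (monoComponent (cp3tree k) col a).ncard
      + (monoComponent (cp3tree k) col b).ncard := by
  obtain ⟨F, hF, hP⟩ := aux_grow (auxGood col a b) (s.length + d)
    (fun t ht hl => auxGood_step col a b t ht (by omega)) s h d le_rfl
  rw [← hF]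
  exact aux_count col a b F (fun t ht => auxGood_center col a b t (hP t ht).1
    (by rw [(hP t ht).2]; exact hd))

theorem aux_outer_adj (i j : Fin 3) (h : i ≠ j) : cp3.Adj (Sum.inl i) (Sum.inl j) := by
  simp only [cp3, SimpleGraph.fromRel_adj]
  exact ⟨by simpa using h, Or.inl (Or.inl ⟨i, j, rfl, rfl⟩)⟩

theorem auxR_outer {k : ℕ} (col : cp3verts k → Fin 2) (i j : Fin 3)
    (h : auxC col (Sum.inl i) = auxC col (Sum.inl j)) :
    auxR col (cp3outer k i) (Sum.inl j) := by
  by_cases hij : i = j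
  · subst hij; exact auxR_refl col (cp3outer k i)
  · exact auxR_adj col _ _ _ (auxR_refl col (cp3outer k i)) (Nat.zero_le k)
      (aux_outer_adj i j hij) h

theorem aux_pair {k : ℕ} (m : ℕ) (hm : 2 * m + 1 < k) (col : cp3verts k → Fin 2) :
    ∃ a b : cp3verts k, 2 ^ m ≤ (monoComponent (cp3tree k) col a).ncard
      + (monoComponent (cp3tree k) col b).ncard := by
  by_cases hbi : ∃ i j : Fin 3, auxC col (Sum.inl i) ≠ auxC col (Sum.inl j)
  · obtain ⟨i, j, hij⟩ := hbi
    refine ⟨cp3outer k i, cp3outer k j, aux_good_bound col _ _ [] ⟨?_, i, j, hij⟩ m ?_⟩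
    · intro l
      have : auxC col (Sum.inl i) = auxC col (Sum.inl l) ∨
          auxC col (Sum.inl j) = auxC col (Sum.inl l) := by omega
      exact this.imp (auxR_outer col i l) (auxR_outer col j l)
    · simp; omega
  · push Not at hbi
    set a := cp3outer k 0 with ha
    by_cases hex : ∃ s : List (Fin 3), s.length ≤ m ∧ (∀ i, auxR col a (cp3corner s i)) ∧
        auxC col (Sum.inr s) ≠ col a
    · obtain ⟨s, hs, hmono, hne⟩ := hex
      have hmem : (Sum.inr s : CP3V) ∈ cp3verts k := by
        change s.length + 1 ≤ k
        omega
      refine ⟨a, ⟨Sum.inr s, hmem⟩, aux_good_bound col _ _ (0 :: s) ⟨?_, 0, 1, ?_⟩ m ?_⟩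
      · intro l
        simp only [cp3corner]
        split_ifs
        · exact Or.inr (auxR_refl col ⟨Sum.inr s, hmem⟩)
        · exact Or.inl (hmono l)
      · have := auxR_col col a _ (hmono 1)
        simpa [cp3corner, this] using hne
      · simp; omega
    · push Not at hex
      have hcen : ∀ t : List (Fin 3), t.length ≤ m → (∀ i, auxR col a (cp3corner t i)) →
          auxR col a (Sum.inr t) := fun t ht h =>
        auxR_center col a t 0 (by omega) (h 0) (by rw [auxR_col col a _ (h 0), hex t ht h])
      have hstep : ∀ t : List (Fin 3), (∀ i, auxR col a (cp3corner t i)) → t.length < m →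
          ∀ j, ∀ i, auxR col a (cp3corner (j :: t) i) := by
        intro t h ht j i
        simp only [cp3corner]
        split_ifs
        · exact hcen t ht.le h
        · exact h i
      obtain ⟨F, hF, hP⟩ := aux_grow (fun t => ∀ i, auxR col a (cp3corner t i)) m
        (fun t ht hl => ⟨0, 1, by decide, hstep t ht hl 0, hstep t ht hl 1⟩) []
        (fun i => auxR_outer col 0 i (hbi 0 i)) m (by simp)
      refine ⟨a, a, ?_⟩
      rw [← hF]
      exact aux_count col a a F (fun t ht => Or.inl (hcen t (by
        have := (hP t ht).2
        simp at this
        omega) (hP t ht).1))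

theorem aux_nat (k : ℕ) (col : cp3verts k → Fin 2) :
    ∃ v : cp3verts k, 2 ^ ((k - 2) / 2) ≤ 2 * (monoComponent (cp3tree k) col v).ncard := by
  by_cases hk : 2 ≤ k
  · obtain ⟨a, b, h⟩ := aux_pair ((k - 2) / 2) (by omega) col
    by_cases hab : (monoComponent (cp3tree k) col a).ncard ≤
        (monoComponent (cp3tree k) col b).ncard
    · exact ⟨b, by omega⟩
    · exact ⟨a, by omega⟩
  · haveI : Finite (cp3verts k) := (aux_finite k).to_subtype
    refine ⟨cp3outer k 0, ?_⟩
    have h1 : 0 < (monoComponent (cp3tree k) col (cp3outer k 0)).ncard :=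
      (Set.ncard_pos (Set.toFinite _)).2 ⟨_, SimpleGraph.Reachable.refl _⟩
    have h2 : (k - 2) / 2 = 0 := by omega
    rw [h2]
    omega

theorem aux_real (k : ℕ) (hk : 1 ≤ k) :
    (1 / 8 : ℝ) * (((3 ^ k + 5) / 2 : ℕ) : ℝ) ^ (Real.logb 3 2 / 2)
      ≤ 2 ^ ((k - 2) / 2) / 2 := by
  set m := (k - 2) / 2 with hm
  have hkm : k + 1 ≤ 2 * (m + 2) := by omega
  have h1 : (3 ^ k + 5) / 2 ≤ 3 ^ (2 * (m + 2)) := by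
    have : 3 ^ (k + 1) ≤ 3 ^ (2 * (m + 2)) := Nat.pow_le_pow_right (by norm_num) hkm
    have h3 : 3 ^ 1 ≤ 3 ^ k := Nat.pow_le_pow_right (by norm_num) hk
    rw [pow_succ] at this
    omega
  have h2 : (((3 ^ k + 5) / 2 : ℕ) : ℝ) ≤ ((3 : ℝ) ^ (m + 2)) ^ (2 : ℝ) := by
    have : (((3 ^ k + 5) / 2 : ℕ) : ℝ) ≤ ((3 ^ (2 * (m + 2)) : ℕ) : ℝ) := by exact_mod_cast h1
    refine this.trans (le_of_eq ?_)
    rw [Real.rpow_two, ← pow_mul]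
    push_cast
    ring
  have hlog : 0 ≤ Real.logb 3 2 := Real.logb_nonneg (by norm_num) (by norm_num)
  have h3 : (((3 ^ k + 5) / 2 : ℕ) : ℝ) ^ (Real.logb 3 2 / 2) ≤ 2 ^ (m + 2) := by
    refine (Real.rpow_le_rpow (Nat.cast_nonneg _) h2 (by positivity)).trans (le_of_eq ?_)
    rw [← Real.rpow_mul (by positivity), mul_div_cancel₀ _ (by norm_num : (2 : ℝ) ≠ 0),
      ← Real.rpow_natCast, ← Real.rpow_mul (by norm_num), mul_comm, Real.rpow_mul (by norm_num),
      Real.rpow_logb (by norm_num) (by norm_num) (by norm_num), Real.rpow_natCast]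
  rw [pow_add] at h3
  linarith

/-- There is a constant `c > 0` such that for every `k ≥ 1`, in every 2-coloring of the
complete planar 3-tree with `k` levels and `n = (3 ^ k + 5) / 2` vertices, some
monochromatic connected component has at least `c * n ^ ((log₃ 2) / 2)` vertices. -/
theorem cp3tree_mcc2_lower :
    ∃ c : ℝ, 0 < c ∧ ∀ k : ℕ, 1 ≤ k →
      ∀ col : cp3verts k → Fin 2,
        ∃ v : cp3verts k,
          c * (((3 ^ k + 5) / 2 : ℕ) : ℝ) ^ (Real.logb 3 2 / 2)
            ≤ ((monoComponent (cp3tree k) col v).ncard : ℝ) := by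
  refine ⟨1 / 8, by norm_num, fun k hk col => ?_⟩
  obtain ⟨v, hv⟩ := aux_nat k col
  refine ⟨v, (aux_real k hk).trans ?_⟩
  have : (2 : ℝ) ^ ((k - 2) / 2) ≤ 2 * ((monoComponent (cp3tree k) col v).ncard : ℝ) := by
    exact_mod_cast hv
  linarith
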